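/- Let A = {1,2,3}, let x ≥ 1 be a real number, and define the cost function C on subsets of A by C({1,2}) = C({1,3}) = 1, C({1}) = C({2}) = C({3}) = x, C({2,3}) = x² + x, and C({1,2,3}) = x³ + x² + x. Then there is no cost-sharing scheme ξ on A that satisfies Fence Monotonicity and is better than (1/x)-budget balanced, i.e., such that (1/x)·C(S) < Σ_{i∈S} ξ(i,S) ≤ C(S) for every nonempty S ⊆ A. -/

import Mathlib

open Finset

variable {n : ℕ}

/-- A cost-sharing scheme: nonnegative payments, and zero payment for non-serviced players. -/
def IsCostSharingScheme (ξ : Fin n → Finset (Fin n) → ℝ) : Prop :=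
  (∀ i S, 0 ≤ ξ i S) ∧ (∀ i S, i ∉ S → ξ i S = 0)

/-- The minimum payment ξ*(i,L,U) = min{ ξ(i,S) : L ⊆ S ⊆ U, i ∈ S }. -/
noncomputable def xiStar (ξ : Fin n → Finset (Fin n) → ℝ) (L U : Finset (Fin n)) (i : Fin n) : ℝ :=
  sInf {x : ℝ | ∃ S : Finset (Fin n), L ⊆ S ∧ S ⊆ U ∧ i ∈ S ∧ ξ i S = x}

/-- Fence Monotonicity at a pair L ⊆ U. -/
def FenceMonoAt (ξ : Fin n → Finset (Fin n) → ℝ) (L U : Finset (Fin n)) : Prop :=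
  (∃ S : Finset (Fin n), L ⊆ S ∧ S ⊆ U ∧ ∀ i ∈ S, ξ i S = xiStar ξ L U i) ∧
  (∀ i ∈ U \ L, ∃ S : Finset (Fin n), L ⊆ S ∧ S ⊆ U ∧ i ∈ S ∧
    ∀ j ∈ S \ L, ξ j S = xiStar ξ L U j) ∧
  (∀ C : Finset (Fin n), C ⊂ U → (∃ i ∈ C, ξ i C < xiStar ξ L U i) →
    ∃ T : Finset (Fin n), T.Nonempty ∧ T ⊆ L \ C ∧ ∀ j ∈ T, ξ j (C ∪ T) = xiStar ξ L U j)

/-- Fence Monotonicity: the three conditions hold at every pair L ⊆ U. -/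
def FenceMonotone (ξ : Fin n → Finset (Fin n) → ℝ) : Prop :=
  ∀ L U : Finset (Fin n), L ⊆ U → FenceMonoAt ξ L U

/-- Voluntary participation: a serviced player is never charged more than her bid. -/
def VP (ξ : Fin n → Finset (Fin n) → ℝ) (O : (Fin n → ℝ) → Finset (Fin n)) : Prop :=
  ∀ b : Fin n → ℝ, ∀ i ∈ O b, ξ i (O b) ≤ b i

/-- Consumer sovereignty: each player has a bid that guarantees service. -/
def CS (O : (Fin n → ℝ) → Finset (Fin n)) : Prop :=
  ∀ i : Fin n, ∃ bstar : ℝ, ∀ b : Fin n → ℝ, b i = bstar → i ∈ O b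

/-- Utility of player `i` with true value `v i` at bid vector `b`. -/
noncomputable def utility (ξ : Fin n → Finset (Fin n) → ℝ) (O : (Fin n → ℝ) → Finset (Fin n))
    (v b : Fin n → ℝ) (i : Fin n) : ℝ :=
  if i ∈ O b then v i - ξ i (O b) else 0

/-- Group-strategyproofness. -/
def GSP (ξ : Fin n → Finset (Fin n) → ℝ) (O : (Fin n → ℝ) → Finset (Fin n)) : Prop :=
  ∀ v v' : Fin n → ℝ,
    (∃ i : Fin n, v i ≠ v' i ∧ utility ξ O v v' i < utility ξ O v v i) ∨
    (∀ i : Fin n, utility ξ O v v' i = utility ξ O v v i)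

/-- The pair (L,U) is stable at the bid vector b. -/
def StablePair (ξ : Fin n → Finset (Fin n) → ℝ) (b : Fin n → ℝ) (L U : Finset (Fin n)) : Prop :=
  L ⊆ U ∧
  (∀ i ∈ L, xiStar ξ L U i < b i) ∧
  (∀ i ∈ U \ L, b i = xiStar ξ L U i) ∧
  (∀ R : Finset (Fin n), R ⊆ Uᶜ → R.Nonempty → ∃ i ∈ R, b i < xiStar ξ L (U ∪ R) i)

/-- Player i harms player j (at the pair L ⊆ U). -/
def Harms (ξ : Fin n → Finset (Fin n) → ℝ) (L U : Finset (Fin n)) (i j : Fin n) : Prop :=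
  j ≠ i ∧ xiStar ξ L U j < xiStar ξ (insert i L) U j

theorem xiStar_le {ξ : Fin n → Finset (Fin n) → ℝ} {L U S : Finset (Fin n)} {i : Fin n}
    (hL : L ⊆ S) (hU : S ⊆ U) (hi : i ∈ S) : xiStar ξ L U i ≤ ξ i S := by
  refine csInf_le (Set.Finite.bddBelow ?_) ⟨S, hL, hU, hi, rfl⟩
  refine (Set.finite_range (ξ i)).subset ?_
  rintro _ ⟨S, -, -, -, rfl⟩
  exact ⟨S, rfl⟩

theorem xiStar_insert (ξ : Fin n → Finset (Fin n) → ℝ) (L : Finset (Fin n)) (i : Fin n) :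
    xiStar ξ L (insert i L) i = ξ i (insert i L) := by
  have : {x : ℝ | ∃ S : Finset (Fin n), L ⊆ S ∧ S ⊆ insert i L ∧ i ∈ S ∧ ξ i S = x} =
      {ξ i (insert i L)} := by
    ext x
    constructor
    · rintro ⟨S, hL, hU, hi, rfl⟩
      rw [hU.antisymm (insert_subset hi hL)]
      rfl
    · rintro rfl
      exact ⟨_, subset_insert i L, Subset.rfl, mem_insert_self i L, rfl⟩
  rw [xiStar, this, csInf_singleton]

namespace FenceMonotone

section ThreePlayers

variable {ξ : Fin 3 → Finset (Fin 3) → ℝ} {a b c : Fin 3}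

/-- If `a` pays less in `{a, b}` than in the full set, then `c` must be a cheap addition. -/
theorem le_of_lt (h : FenceMonotone ξ) (hab : a ≠ b) (hac : a ≠ c) (hbc : b ≠ c)
    (hlt : ξ a {a, b} < ξ a univ) : ξ c univ ≤ ξ c {b, c} := by
  have hU : insert a {b, c} = (univ : Finset (Fin 3)) := by
    clear hlt; revert a b c; decide
  have hC : ({a, b} : Finset (Fin 3)) ⊂ univ := by
    clear hlt hU; revert a b c; decide
  have hstar : xiStar ξ {b, c} univ a = ξ a univ := by
    rw [← hU, xiStar_insert]
  obtain ⟨T, hT, hTs, hTe⟩ := (h {b, c} univ (subset_univ _)).2.2 {a, b} hC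
    ⟨a, by simp, by rwa [hstar]⟩
  have hTc : T = {c} := by
    clear hlt hU hC hstar hTe; revert a b c T; decide
  have hUc : ({a, b} : Finset (Fin 3)) ∪ {c} = univ := by
    clear hlt hU hC hstar hTs hTe hTc; revert a b c; decide
  have hc := hTe c (by simp [hTc])
  rw [hTc, hUc] at hc
  exact hc.trans_le (xiStar_le Subset.rfl (subset_univ _) (by simp))

theorem le_univ_or (h : FenceMonotone ξ) (hab : a ≠ b) (hac : a ≠ c) (hbc : b ≠ c) :
    ξ c {b, c} ≤ ξ c univ ∨ ξ a univ ≤ ξ a {a, b} ∧ ξ c univ ≤ ξ c {b, c} := by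
  obtain ⟨S, hL, -, hc, hS⟩ := (h {b} univ (subset_univ _)).2.1 c (by simp [hbc.symm])
  have hcases : S = {b, c} ∨ S = univ := by
    clear hS; revert a b c S; decide
  rcases hcases with rfl | rfl
  · exact .inl ((hS c (by simp [hbc.symm])).trans_le
      (xiStar_le (subset_univ _) Subset.rfl (mem_univ _)))
  · exact .inr ⟨(hS a (by simp [hab])).trans_le
        (xiStar_le (by simp) (subset_univ _) (by simp)),
      (hS c (by simp [hbc.symm])).trans_le
        (xiStar_le (by simp) (subset_univ _) (by simp))⟩

theorem pair_le_univ_or (h : FenceMonotone ξ) (hab : a ≠ b) (hac : a ≠ c) (hbc : b ≠ c) :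
    ξ b {b, c} ≤ ξ b univ ∨ ξ c univ ≤ ξ c {b, c} := by
  obtain ⟨S, hL, -, hS⟩ := (h {b, c} univ (subset_univ _)).1
  have hcases : S = {b, c} ∨ S = univ := by
    clear hS; revert a b c S; decide
  rcases hcases with rfl | rfl
  · exact .inl ((hS b (by simp)).trans_le
      (xiStar_le (subset_univ _) Subset.rfl (mem_univ _)))
  · exact .inr ((hS c (mem_univ _)).trans_le
      (xiStar_le Subset.rfl (subset_univ _) (by simp)))

theorem singleton_le_or (h : FenceMonotone ξ) :
    ξ b {b} ≤ ξ b {b, c} ∨ ξ c {b, c} ≤ ξ c {c} := by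
  obtain ⟨S, -, hU, hb, hS⟩ := (h ∅ {b, c} (empty_subset _)).2.1 b (by simp)
  have hcases : S = {b} ∨ S = {b, c} := by
    clear hS; revert b c S; decide
  rcases hcases with rfl | rfl
  · exact .inl ((hS b (by simp)).trans_le
      (xiStar_le (empty_subset _) Subset.rfl (by simp)))
  · exact .inr ((hS c (by simp)).trans_le
      (xiStar_le (empty_subset _) (by simp) (by simp)))

theorem lt_univ_of_budget (h : FenceMonotone ξ) (h0 : ∀ i S, 0 ≤ ξ i S)
    (hab : a ≠ b) (hac : a ≠ c) (hbc : b ≠ c) {x : ℝ} (hb : 1 < ξ b {b}) (hc : ξ c {c} ≤ x)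
    (hpab : ξ a {a, b} + ξ b {a, b} ≤ 1) (hpac : ξ a {a, c} + ξ c {a, c} ≤ 1)
    (hpbc : x + 1 < ξ b {b, c} + ξ c {b, c}) (hpbc' : ξ b {b, c} + ξ c {b, c} ≤ x ^ 2 + x)
    (htot : x ^ 2 + x + 1 < ξ a univ + ξ b univ + ξ c univ) :
    ξ b {a, b} < ξ b univ := by
  by_contra! htb
  have key : ¬ ξ b {b, c} ≤ ξ b univ := by
    intro hle
    have := h0 a {a, b}
    rcases h.singleton_le_or (b := b) (c := c) with h' | h' <;> linarith
  have hcle : ξ c univ ≤ ξ c {b, c} := (h.pair_le_univ_or hab hac hbc).resolve_left key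
  have hale : ξ a univ ≤ ξ a {a, c} := by
    have := h.le_univ_or hac hab hbc.symm
    rw [pair_comm c b] at this
    exact (this.resolve_left key).1
  linarith [h0 c {a, c}]

end ThreePlayers

end FenceMonotone

/-- For the three-player cost function parameterized by x ≥ 1, no
cost-sharing scheme satisfying Fence Monotonicity is better than (1/x)-budget balanced. -/
theorem stmt17 (x : ℝ) (hx : 1 ≤ x) (C : Finset (Fin 3) → ℝ)
    (hC12 : C {0, 1} = 1) (hC13 : C {0, 2} = 1)
    (hC1 : C {0} = x) (hC2 : C {1} = x) (hC3 : C {2} = x)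
    (hC23 : C {1, 2} = x ^ 2 + x) (hC123 : C {0, 1, 2} = x ^ 3 + x ^ 2 + x) :
    ¬ ∃ ξ : Fin 3 → Finset (Fin 3) → ℝ, IsCostSharingScheme ξ ∧ FenceMonotone ξ ∧
      ∀ S : Finset (Fin 3), S.Nonempty →
        (1 / x) * C S < ∑ i ∈ S, ξ i S ∧ ∑ i ∈ S, ξ i S ≤ C S := by
  rintro ⟨ξ, ⟨h0, -⟩, h, hbb⟩
  have hx0 : 0 < x := by linarith
  have huniv : ({0, 1, 2} : Finset (Fin 3)) = univ := by decide
  have h1 := hbb {1} (by simp)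
  have h2 := hbb {2} (by simp)
  have h01 := (hbb {0, 1} (by simp)).2
  have h02 := (hbb {0, 2} (by simp)).2
  have h12 := hbb {1, 2} (by simp)
  have htot := (hbb {0, 1, 2} (by simp)).1
  rw [hC2, sum_singleton, one_div_mul_cancel hx0.ne'] at h1
  rw [hC3, sum_singleton, one_div_mul_cancel hx0.ne'] at h2
  rw [hC12, sum_pair (by decide)] at h01
  rw [hC13, sum_pair (by decide)] at h02
  rw [hC23, sum_pair (by decide), show 1 / x * (x ^ 2 + x) = x + 1 by field_simp] at h12
  rw [hC123, huniv, Fin.sum_univ_three,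
    show 1 / x * (x ^ 3 + x ^ 2 + x) = x ^ 2 + x + 1 by field_simp] at htot
  have hlt₁ : ξ 1 {0, 1} < ξ 1 univ :=
    h.lt_univ_of_budget h0 (by decide) (by decide) (by decide) h1.1 h2.2 h01 h02 h12.1 h12.2 htot
  have hlt₂ : ξ 2 {0, 2} < ξ 2 univ :=
    h.lt_univ_of_budget h0 (by decide) (by decide) (by decide) h2.1 h1.2 h02 h01
      (by rw [pair_comm]; linarith) (by rw [pair_comm]; linarith) (by linarith)
  rw [pair_comm] at hlt₂
  exact hlt₁.not_ge (h.le_of_lt (by decide) (by decide) (by decide) hlt₂)
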